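/- arXiv:quant-ph/0511063 — 2 statements merged into one kernel-verified Lean document; each statement's English description precedes it below -/
import Mathlib

section
/- Let A be an n×n real matrix (n ≥ 1) all of whose entries are positive and such that every column of A sums to 1. Then the solution space {X ∈ ℝⁿ : (I − A)·X = 0} is one-dimensional, i.e. the kernel of the linear map X ↦ X − A·X has dimension exactly 1 over ℝ (the system has a one-parameter family of solutions). -/
/-- A square matrix over a field and its transpose have kernels of the same dimension. -/
theorem Matrix.finrank_ker_mulVecLin_transpose {ι K : Type*} [Fintype ι] [Field K]
    (M : Matrix ι ι K) :
    Module.finrank K (LinearMap.ker M.transpose.mulVecLin) =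
      Module.finrank K (LinearMap.ker M.mulVecLin) := by
  have h₁ := M.mulVecLin.finrank_range_add_finrank_ker
  have h₂ := M.transpose.mulVecLin.finrank_range_add_finrank_ker
  have h₃ := M.rank_transpose
  unfold Matrix.rank at h₃
  omega

/-- Maximum principle: a fixed vector of a positive row-stochastic matrix is constant. -/
theorem Matrix.eq_of_mulVec_eq_self_of_pos {ι : Type*} [Fintype ι] {B : Matrix ι ι ℝ}
    (hpos : ∀ i j, 0 < B i j) (hrow : ∀ i, ∑ j, B i j = 1) {x : ι → ℝ}
    (hx : B.mulVec x = x) (i j : ι) : x i = x j := by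
  have : Nonempty ι := ⟨i⟩
  obtain ⟨m, hm⟩ := Finite.exists_max x
  have hsum : ∑ k, B m k * (x m - x k) = 0 := by
    have hxm : ∑ k, B m k * x k = x m := congrFun hx m
    simp only [mul_sub, Finset.sum_sub_distrib, ← Finset.sum_mul, hrow, hxm, one_mul, sub_self]
  have hmax (k : ι) : x m = x k := by
    have hk := (Finset.sum_eq_zero_iff_of_nonneg fun k _ =>
      mul_nonneg (hpos m k).le (sub_nonneg.2 (hm k))).1 hsum k (Finset.mem_univ k)
    exact sub_eq_zero.1 ((mul_eq_zero.1 hk).resolve_left (hpos m k).ne')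
  rw [← hmax i, ← hmax j]

/-- Closed Leontief model, uniqueness: if all entries of the `n × n` real matrix `A`
are positive and every column of `A` sums to `1`, then the solution space of
`(I - A) X = 0`, i.e. the kernel of `X ↦ X - A ⬝ X`, is one-dimensional. -/
theorem closed_leontief_solution_space_one_dimensional
    (n : ℕ) (hn : 1 ≤ n) (A : Matrix (Fin n) (Fin n) ℝ)
    (hpos : ∀ i j, 0 < A i j)
    (hcol : ∀ j, (∑ i, A i j) = 1) :
    Module.finrank ℝ (LinearMap.ker ((1 - A : Matrix (Fin n) (Fin n) ℝ).mulVecLin)) = 1 := by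
  have mem_ker (x : Fin n → ℝ) :
      x ∈ LinearMap.ker (1 - A).transpose.mulVecLin ↔ A.transpose.mulVec x = x := by
    rw [LinearMap.mem_ker, Matrix.mulVecLin_apply, Matrix.transpose_sub, Matrix.transpose_one,
      Matrix.sub_mulVec, Matrix.one_mulVec, sub_eq_zero, eq_comm]
  have hone : (1 : Fin n → ℝ) ∈ LinearMap.ker (1 - A).transpose.mulVecLin := by
    rw [mem_ker]
    ext j
    simp [Matrix.mulVec, dotProduct, hcol]
  let i₀ : Fin n := ⟨0, hn⟩
  rw [← Matrix.finrank_ker_mulVecLin_transpose]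
  refine finrank_eq_one ⟨1, hone⟩ (fun h => ?_) fun w => ⟨w.1 i₀, ?_⟩
  · exact one_ne_zero (congrFun (congrArg Subtype.val h) i₀)
  · ext j
    simpa using Matrix.eq_of_mulVec_eq_self_of_pos (fun i j => hpos j i) hcol
      ((mem_ker w.1).1 w.2) i₀ j
end

section
/- Let A be an n×n real matrix all of whose entries are positive and such that every column of A sums to strictly less than 1. Then the matrix I − A is invertible. -/
/-- Open Leontief model, invertibility: if all entries of the `n × n` real matrix `A`
are positive and every column of `A` sums to strictly less than `1`, then `I - A`
is invertible. -/
theorem open_leontief_isUnit_one_sub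
    (n : ℕ) (A : Matrix (Fin n) (Fin n) ℝ)
    (hpos : ∀ i j, 0 < A i j)
    (hcol : ∀ j, (∑ i, A i j) < 1) :
    IsUnit (1 - A) := by
  rw [Matrix.isUnit_iff_isUnit_det, isUnit_iff_ne_zero]
  refine det_ne_zero_of_sum_col_lt_diag fun k => ?_
  have hsum : ∑ i ∈ Finset.univ.erase k, ‖(1 - A) i k‖ = ∑ i ∈ Finset.univ.erase k, A i k :=
    Finset.sum_congr rfl fun i hi => by
      rw [Matrix.sub_apply, Matrix.one_apply_ne (Finset.ne_of_mem_erase hi), zero_sub, norm_neg,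
        Real.norm_of_nonneg (hpos i k).le]
  have hdiag : 1 - A k k ≤ ‖(1 - A) k k‖ := by
    rw [Matrix.sub_apply, Matrix.one_apply_eq]
    exact Real.le_norm_self _
  have hsplit := Finset.add_sum_erase Finset.univ (fun i => A i k) (Finset.mem_univ k)
  linarith [hcol k]
end
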